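/- If u ∈ Ḣ¹(ℝ⁴) satisfies ‖∇u‖_{L²} ≤ ‖∇W‖_{L²}, then E(u) = ∫(½|∇u|² − ¼|u|⁴)dx ≥ 0. -/

import Mathlib

open MeasureTheory

/-- The ground state `W(x) = (1 + |x|²/8)⁻¹` on `ℝ⁴`. -/
noncomputable def W (x : EuclideanSpace ℝ (Fin 4)) : ℝ := (1 + ‖x‖ ^ 2 / 8)⁻¹


open scoped FourierTransform ENNReal ContDiff
open Real SchwartzMap

abbrev E4 := EuclideanSpace ℝ (Fin 4)
noncomputable abbrev L2E := Lp (α := E4) ℂ 2 volume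

lemma fourier_ae_eq (g : E4 → ℂ) (h1 : Integrable g) (h2 : MemLp g 2 volume) :
    ((𝓕 (h2.toLp g) : L2E) : E4 → ℂ) =ᵐ[volume] 𝓕 g := by
  have hc : Continuous (𝓕 g) :=
    VectorFourier.fourierIntegral_continuous Real.continuous_fourierChar
      (by exact continuous_inner) h1
  refine ae_eq_of_integral_contDiff_smul_eq ?_ hc.locallyIntegrable ?_
  · exact (Lp.memLp _).locallyIntegrable (by norm_num)
  · intro φ φs φc
    have hg₁ : HasCompactSupport (Complex.ofRealCLM ∘ φ) := φc.comp_left rfl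
    have hg₂ : ContDiff ℝ ∞ (Complex.ofRealCLM ∘ φ) := by fun_prop
    set ψ : 𝓢(E4, ℂ) := hg₁.toSchwartzMap hg₂ with hψ
    have e1 : ∫ x, φ x • (𝓕 (h2.toLp g) : L2E) x
        = Lp.toTemperedDistribution (𝓕 (h2.toLp g) : L2E) ψ := by
      rw [Lp.toTemperedDistribution_apply]
      simp [hψ]
    have e2 : ∫ x, φ x • 𝓕 g x = ∫ x, ψ x * 𝓕 g x := by simp [hψ]
    rw [e1, e2, ← Lp.fourier_toTemperedDistribution_eq, TemperedDistribution.fourier_apply,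
      Lp.toTemperedDistribution_apply]
    have e3 : ∫ x, (𝓕 ψ) x • (h2.toLp g) x = ∫ x, (𝓕 (ψ : E4 → ℂ)) x • g x := by
      apply integral_congr_ae
      filter_upwards [h2.coeFn_toLp] with x hx
      rw [hx, SchwartzMap.fourier_coe]
    rw [e3]
    have := VectorFourier.integral_fourierIntegral_smul_eq_flip (L := innerₗ E4)
      (μ := volume) (ν := volume) Real.continuous_fourierChar
      (by exact continuous_inner) (f := (ψ : E4 → ℂ)) (g := g) ψ.integrable h1
    simpa [smul_eq_mul] using! this

lemma fourierInv_ae_eq (g : E4 → ℂ) (h1 : Integrable g) (h2 : MemLp g 2 volume) :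
    ((𝓕⁻ (h2.toLp g) : L2E) : E4 → ℂ) =ᵐ[volume] 𝓕⁻ g := by
  have hco : (𝓕⁻ g) = 𝓕 (fun x => g (-x)) := fourierInv_eq_fourier_comp_neg g
  have hc : Continuous (𝓕⁻ g) := by
    rw [hco]
    exact VectorFourier.fourierIntegral_continuous Real.continuous_fourierChar
      (by exact continuous_inner) h1.comp_neg
  refine ae_eq_of_integral_contDiff_smul_eq ?_ hc.locallyIntegrable ?_
  · exact (Lp.memLp _).locallyIntegrable (by norm_num)
  · intro φ φs φc
    have hg₁ : HasCompactSupport (Complex.ofRealCLM ∘ φ) := φc.comp_left rfl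
    have hg₂ : ContDiff ℝ ∞ (Complex.ofRealCLM ∘ φ) := by fun_prop
    set ψ : 𝓢(E4, ℂ) := hg₁.toSchwartzMap hg₂ with hψ
    have e1 : ∫ x, φ x • (𝓕⁻ (h2.toLp g) : L2E) x
        = Lp.toTemperedDistribution (𝓕⁻ (h2.toLp g) : L2E) ψ := by
      rw [Lp.toTemperedDistribution_apply]
      simp [hψ]
    have e2 : ∫ x, φ x • 𝓕⁻ g x = ∫ x, ψ x * 𝓕⁻ g x := by simp [hψ]
    rw [e1, e2, ← Lp.fourierInv_toTemperedDistribution_eq, TemperedDistribution.fourierInv_apply,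
      Lp.toTemperedDistribution_apply]
    have e3 : ∫ x, (𝓕⁻ ψ) x • (h2.toLp g) x = ∫ x, (𝓕⁻ (ψ : E4 → ℂ)) x • g x := by
      apply integral_congr_ae
      filter_upwards [h2.coeFn_toLp] with x hx
      rw [hx, SchwartzMap.fourierInv_coe]
    rw [e3, hco]
    have := VectorFourier.integral_fourierIntegral_smul_eq_flip (L := innerₗ E4)
      (μ := volume) (ν := volume) Real.continuous_fourierChar
      (by exact continuous_inner) (f := (ψ : E4 → ℂ)) (g := fun x => g (-x)) ψ.integrable h1.comp_neg
    have h3 : ∫ x, (𝓕 (ψ : E4 → ℂ)) x • g (-x) = ∫ x, ψ x • 𝓕 (fun x => g (-x)) x := by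
      simpa [smul_eq_mul] using! this
    simp only [smul_eq_mul] at h3 ⊢
    rw [← h3, ← integral_neg_eq_self]
    simp [fourierInv_eq_fourier_neg]

lemma lint_sq (f : E4 → ℂ) : ∫⁻ x, ‖f x‖ₑ ^ 2 = eLpNorm f 2 volume ^ 2 := by
  rw [eLpNorm_eq_lintegral_rpow_enorm_toReal (by norm_num) (by norm_num)]
  simp only [ENNReal.toReal_ofNat]
  rw [← ENNReal.rpow_natCast, ← ENNReal.rpow_mul]
  norm_num

lemma lp_sq (f : L2E) : eLpNorm f 2 volume = ENNReal.ofReal ‖f‖ := by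
  rw [Lp.norm_def, ENNReal.ofReal_toReal (Lp.eLpNorm_ne_top f)]

lemma planch (g : E4 → ℂ) (h1 : Integrable g) (h2 : MemLp g 2 volume) :
    ∫⁻ x, ‖𝓕 g x‖ₑ ^ 2 = ∫⁻ x, ‖g x‖ₑ ^ 2 := by
  rw [lint_sq, lint_sq, ← eLpNorm_congr_ae (fourier_ae_eq g h1 h2), lp_sq, Lp.norm_fourier_eq,
    ← lp_sq, eLpNorm_congr_ae h2.coeFn_toLp]

lemma fi_sub (f g : L2E) : (𝓕⁻ (f - g) : L2E) = 𝓕⁻ f - 𝓕⁻ g :=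
  (Lp.fourierTransformₗᵢ E4 ℂ).symm.map_sub f g

lemma fourier_split (v : E4 → ℂ) (h1 : Integrable v) (h2 : MemLp v 2 volume)
    (L : Set E4) (hL : MeasurableSet L) (C : ℝ≥0∞) (hC : C ≠ ⊤)
    (hb : ∫⁻ ξ in L, ‖𝓕 v ξ‖ₑ ≤ C) :
    ∃ low : E4 → ℂ, (∀ x, ‖low x‖ₑ ≤ C) ∧
      ∫⁻ x, ‖v x - low x‖ₑ ^ 2 ≤ ∫⁻ ξ in Lᶜ, ‖𝓕 v ξ‖ₑ ^ 2 := by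
  have hc : Continuous (𝓕 v) :=
    VectorFourier.fourierIntegral_continuous Real.continuous_fourierChar
      (by exact continuous_inner) h1
  have hF2 : MemLp (𝓕 v) 2 volume := (memLp_congr_ae (fourier_ae_eq v h1 h2)).1 (Lp.memLp _)
  set k : E4 → ℂ := L.indicator (𝓕 v) with hk
  have k2 : MemLp k 2 volume := hF2.indicator hL
  have kn : ∫⁻ x, ‖k x‖ₑ = ∫⁻ ξ in L, ‖𝓕 v ξ‖ₑ := by
    rw [← lintegral_indicator hL]
    congr 1; ext x; by_cases hx : x ∈ L <;> simp [hk, hx]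
  have k1 : Integrable k := ⟨k2.1, by
    rw [hasFiniteIntegral_iff_enorm, kn]; exact hb.trans_lt hC.lt_top⟩
  refine ⟨𝓕⁻ k, ?_, ?_⟩
  · intro x
    rw [fourierInv_eq]
    refine (enorm_integral_le_lintegral_enorm _).trans ?_
    refine le_trans (le_of_eq ?_) (kn.le.trans hb)
    congr 1; ext y
    exact enorm_eq_iff_norm_eq.2 (Circle.norm_smul _ _)
  · have key : (h2.toLp v - 𝓕⁻ (k2.toLp k) : L2E)
        = 𝓕⁻ (𝓕 (h2.toLp v) - k2.toLp k) := by
      rw [fi_sub, FourierTransform.fourierInv_fourier_eq]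
    have hn : ‖(h2.toLp v - 𝓕⁻ (k2.toLp k) : L2E)‖
        = ‖(𝓕 (h2.toLp v) - k2.toLp k : L2E)‖ := by
      rw [key]; exact (Lp.fourierTransformₗᵢ E4 ℂ).symm.norm_map _
    have e1 : ((h2.toLp v - 𝓕⁻ (k2.toLp k) : L2E) : E4 → ℂ) =ᵐ[volume]
        fun x => v x - 𝓕⁻ k x := by
      filter_upwards [Lp.coeFn_sub (h2.toLp v) (𝓕⁻ (k2.toLp k)), h2.coeFn_toLp,
        fourierInv_ae_eq k k1 k2] with x a b c
      rw [a, Pi.sub_apply, b, c]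
    have e2 : ((𝓕 (h2.toLp v) - k2.toLp k : L2E) : E4 → ℂ) =ᵐ[volume]
        Lᶜ.indicator (𝓕 v) := by
      filter_upwards [Lp.coeFn_sub (𝓕 (h2.toLp v)) (k2.toLp k), k2.coeFn_toLp,
        fourier_ae_eq v h1 h2] with x a b c
      rw [a, Pi.sub_apply, b, c]
      by_cases hx : x ∈ L <;> simp [hk, hx]
    rw [lint_sq, ← eLpNorm_congr_ae e1, lp_sq, hn, ← lp_sq, eLpNorm_congr_ae e2, ← lint_sq,
      ← lintegral_indicator hL.compl]
    apply le_of_eq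
    congr 1; ext x; by_cases hx : x ∈ L <;> simp [hx]

lemma vol_ball4 : (volume : Measure E4).real (Metric.ball 0 1) = π ^ 2 / 2 := by
  rw [Measure.real, EuclideanSpace.volume_ball]
  have h : Real.Gamma (((Fintype.card (Fin 4) : ℕ) : ℝ) / 2 + 1) = 2 := by
    have := Real.Gamma_nat_eq_factorial 2
    norm_num at this ⊢
  have h2 : √π ^ 4 = π ^ 2 := by
    rw [show (4 : ℕ) = 2 * 2 from rfl, pow_mul, Real.sq_sqrt pi_pos.le]
  rw [h]
  simp only [Fintype.card_fin, h2]
  rw [ENNReal.toReal_mul, ENNReal.toReal_ofReal (by positivity)]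
  simp

lemma polar4 (f : ℝ → ℝ) :
    ∫ x : E4, f ‖x‖ = 2 * π ^ 2 * ∫ y in Set.Ioi (0 : ℝ), y ^ 3 * f y := by
  rw [integral_fun_norm_addHaar, vol_ball4]
  simp only [finrank_euclideanSpace, Fintype.card_fin, smul_eq_mul, nsmul_eq_mul]
  norm_num
  ring

/-- `∫_{|ξ| ≤ r} |ξ|⁻² dξ ≤ π² r²`. -/
lemma lint_inv_sq (r : ℝ) (hr : 0 ≤ r) :
    ∫⁻ ξ in Metric.closedBall (0 : E4) r, ENNReal.ofReal (‖ξ‖⁻¹) ^ 2 ≤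
      ENNReal.ofReal (π ^ 2 * r ^ 2) := by
  let f : ℝ → ℝ := (Set.Iic r).indicator (fun y => (y⁻¹) ^ 2)
  have hf : ∀ y, 0 ≤ f y := fun y => Set.indicator_nonneg (fun y _ => by positivity) y
  have e0 : ∫⁻ ξ in Metric.closedBall (0 : E4) r, ENNReal.ofReal (‖ξ‖⁻¹) ^ 2
      = ∫⁻ ξ : E4, ENNReal.ofReal (f ‖ξ‖) := by
    rw [← lintegral_indicator measurableSet_closedBall]
    congr 1; ext ξ
    by_cases h : ‖ξ‖ ≤ r
    · rw [Set.indicator_of_mem (by simpa using h)]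
      simp only [f]
      rw [Set.indicator_of_mem (by simpa using h), ENNReal.ofReal_pow (by positivity)]
    · rw [Set.indicator_of_notMem (by simpa using h)]
      simp only [f]
      rw [Set.indicator_of_notMem (by simpa using h)]; simp
  have e1 : ∀ y ∈ Set.Ioi (0 : ℝ), y ^ 3 * f y = (Set.Ioc 0 r).indicator (fun y => y) y := by
    intro y hy
    have hy' : (0 : ℝ) < y := hy
    by_cases h : y ≤ r
    · rw [Set.indicator_of_mem (by exact ⟨hy', h⟩)]
      simp only [f]
      rw [Set.indicator_of_mem (by simpa using h)]
      field_simp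
    · rw [Set.indicator_of_notMem (by intro h'; exact h h'.2)]
      simp only [f]
      rw [Set.indicator_of_notMem (by simpa using h)]; simp
  have hI : Integrable (fun ξ : E4 => f ‖ξ‖) := by
    rw [integrable_fun_norm_addHaar]
    simp only [finrank_euclideanSpace, Fintype.card_fin, smul_eq_mul]
    rw [integrableOn_congr_fun e1 measurableSet_Ioi]
    apply Integrable.integrableOn
    rw [integrable_indicator_iff measurableSet_Ioc]
    exact (continuous_id.integrableOn_Icc (a := 0) (b := r)).mono_set Set.Ioc_subset_Icc_self
  rw [e0, ← ofReal_integral_eq_lintegral_ofReal hI (Filter.Eventually.of_forall fun ξ => hf _)]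
  apply ENNReal.ofReal_le_ofReal
  rw [polar4, setIntegral_congr_fun measurableSet_Ioi e1, setIntegral_indicator measurableSet_Ioc]
  have : Set.Ioi (0 : ℝ) ∩ Set.Ioc 0 r = Set.Ioc 0 r := by
    ext y; simp
  rw [this, ← intervalIntegral.integral_of_le hr, integral_id]
  apply le_of_eq; ring

/-- Weighted energy density. -/
noncomputable def gdens (q : E4 → ℝ≥0∞) (ξ : E4) : ℝ≥0∞ := ‖ξ‖ₑ ^ 2 * q ξ ^ 2

/-- `Λ(ξ) = π² |ξ|² ∫_{|η| ≤ |ξ|} g`. -/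
noncomputable def Lam (q : E4 → ℝ≥0∞) (r : ℝ) : ℝ≥0∞ :=
  ENNReal.ofReal (π ^ 2 * r ^ 2) * ∫⁻ η in Metric.closedBall (0 : E4) r, gdens q η

lemma gdens_meas {q : E4 → ℝ≥0∞} (hq : Measurable q) : Measurable (gdens q) := by
  unfold gdens; fun_prop

lemma Lam_mono (q : E4 → ℝ≥0∞) {r s : ℝ} (hr : 0 ≤ r) (h : r ≤ s) : Lam q r ≤ Lam q s := by
  unfold Lam
  gcongr

lemma cs_ball (q : E4 → ℝ≥0∞) (hq : Measurable q) (r : ℝ) (hr : 0 ≤ r) :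
    (∫⁻ ξ in Metric.closedBall (0 : E4) r, q ξ) ^ 2 ≤ Lam q r := by
  have e : ∫⁻ ξ in Metric.closedBall (0 : E4) r, q ξ =
      ∫⁻ ξ in Metric.closedBall (0 : E4) r, ENNReal.ofReal (‖ξ‖⁻¹) * (‖ξ‖ₑ * q ξ) := by
    apply lintegral_congr_ae
    apply ae_restrict_of_ae
    have : ∀ᵐ ξ : E4, ξ ≠ 0 := by
      simp [ae_iff]
    filter_upwards [this] with ξ hξ
    rw [← mul_assoc, ← ofReal_norm, ← ENNReal.ofReal_mul (by positivity),
      inv_mul_cancel₀ (norm_ne_zero_iff.2 hξ)]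
    simp
  rw [e]
  have h := ENNReal.lintegral_mul_le_Lp_mul_Lq (volume.restrict (Metric.closedBall (0 : E4) r))
    (p := 2) (q := 2) (by constructor <;> norm_num) (f := fun ξ => ENNReal.ofReal (‖ξ‖⁻¹))
    (g := fun ξ => ‖ξ‖ₑ * q ξ) (by fun_prop) (by fun_prop)
  have h' := pow_le_pow_left₀ (zero_le) h 2
  refine h'.trans ?_
  rw [mul_pow, ← ENNReal.rpow_natCast, ← ENNReal.rpow_natCast, ← ENNReal.rpow_mul,
    ← ENNReal.rpow_mul]
  norm_num
  unfold Lam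
  refine mul_le_mul' (lint_inv_sq r hr) (le_of_eq ?_)
  congr 1; ext ξ; unfold gdens; rw [mul_pow]

lemma lowset_bound (q : E4 → ℝ≥0∞) (hq : Measurable q) (t C : ℝ≥0∞) (htC : t = C ^ 2) :
    ∫⁻ ξ in {ξ : E4 | Lam q ‖ξ‖ < t}, q ξ ≤ C := by
  have hball : ∀ r, 0 ≤ r → Lam q r < t → ∫⁻ ξ in Metric.closedBall (0 : E4) r, q ξ ≤ C := by
    intro r hr h
    have := (cs_ball q hq r hr).trans h.le
    rw [htC] at this
    exact (ENNReal.pow_le_pow_left_iff (by norm_num)).1 this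
  have hun : ∀ u : ℕ → ℝ, Monotone u → (∀ n, 0 ≤ u n ∧ Lam q (u n) < t) →
      {ξ : E4 | Lam q ‖ξ‖ < t} ⊆ ⋃ n, Metric.closedBall (0 : E4) (u n) →
      ∫⁻ ξ in {ξ : E4 | Lam q ‖ξ‖ < t}, q ξ ≤ C := by
    intro u hu h1 h2
    refine (lintegral_mono_set h2).trans ?_
    rw [setLIntegral_iUnion_of_directed]
    · exact iSup_le fun n => hball _ (h1 n).1 (h1 n).2
    · exact Monotone.directed_le fun a b hab => Metric.closedBall_subset_closedBall (hu hab)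
  set S : Set ℝ := {r | 0 ≤ r ∧ Lam q r < t} with hS
  by_cases hne : S.Nonempty
  swap
  · have : {ξ : E4 | Lam q ‖ξ‖ < t} = ∅ := by
      ext ξ; simp only [Set.mem_ofPred_eq, Set.mem_empty_iff_false, iff_false]
      intro h
      exact hne ⟨‖ξ‖, norm_nonneg _, h⟩
    rw [this]; simp
  by_cases hb : BddAbove S
  · have hlub := isLUB_csSup hne hb
    by_cases ha : sSup S ∈ S
    · refine hun (fun _ => sSup S) (fun _ _ _ => le_rfl) (fun _ => ha) ?_
      intro ξ hξ
      simp only [Set.mem_iUnion, mem_closedBall_zero_iff, exists_const]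
      exact hlub.1 ⟨norm_nonneg _, hξ⟩
    · obtain ⟨u, hu, _, hlim, hmem⟩ := hlub.exists_seq_monotone_tendsto hne
      refine hun u hu hmem ?_
      intro ξ hξ
      have hξS : ‖ξ‖ ∈ S := ⟨norm_nonneg _, hξ⟩
      have hlt : ‖ξ‖ < sSup S := lt_of_le_of_ne (hlub.1 hξS) (fun h => ha (h ▸ hξS))
      obtain ⟨n, hn⟩ := (hlim.eventually (lt_mem_nhds hlt)).exists
      simp only [Set.mem_iUnion, mem_closedBall_zero_iff]
      exact ⟨n, hn.le⟩
  · refine hun (fun n => (n : ℝ)) Nat.mono_cast (fun n => ⟨by positivity, ?_⟩) ?_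
    · rw [not_bddAbove_iff] at hb
      obtain ⟨s, hs, hns⟩ := hb n
      exact (Lam_mono q (by positivity) hns.le).trans_lt hs.2
    · intro ξ _
      obtain ⟨n, hn⟩ := exists_nat_ge ‖ξ‖
      simp only [Set.mem_iUnion, mem_closedBall_zero_iff]
      exact ⟨n, hn⟩

lemma sym_bound (q : E4 → ℝ≥0∞) (hq : Measurable q) :
    2 * ∫⁻ ξ, q ξ ^ 2 * Lam q ‖ξ‖ ≤ ENNReal.ofReal (π ^ 2) * (∫⁻ ξ, gdens q ξ) ^ 2 := by
  have hg := gdens_meas hq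
  set g := gdens q with hgd
  let k : E4 → E4 → ℝ≥0∞ := fun ξ η => if ‖η‖ ≤ ‖ξ‖ then g ξ * g η else 0
  have hk : Measurable (Function.uncurry k) := by
    refine Measurable.ite ?_ (by fun_prop) measurable_const
    exact measurableSet_le (by fun_prop) (by fun_prop)
  have e1 : ∀ ξ, q ξ ^ 2 * Lam q ‖ξ‖ = ENNReal.ofReal (π ^ 2) * ∫⁻ η, k ξ η := by
    intro ξ
    have : ∫⁻ η, k ξ η = g ξ * ∫⁻ η in Metric.closedBall (0 : E4) ‖ξ‖, g η := by
      rw [← lintegral_const_mul _ hg, ← lintegral_indicator measurableSet_closedBall]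
      congr 1; ext η
      by_cases h : ‖η‖ ≤ ‖ξ‖ <;> simp [k, h, Set.indicator]
    rw [this]
    unfold Lam
    rw [ENNReal.ofReal_mul (by positivity), ← hgd, ENNReal.ofReal_pow (norm_nonneg _), ofReal_norm]
    simp only [hgd]
    rw [show gdens q ξ = ‖ξ‖ₑ ^ 2 * q ξ ^ 2 from rfl]
    ring
  have e2 : ∫⁻ ξ, q ξ ^ 2 * Lam q ‖ξ‖ = ENNReal.ofReal (π ^ 2) * ∫⁻ ξ, ∫⁻ η, k ξ η := by
    simp_rw [e1]
    rw [lintegral_const_mul _ hk.lintegral_prod_right]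
  have e3 : ∫⁻ ξ, ∫⁻ η, k ξ η = ∫⁻ ξ, ∫⁻ η, k η ξ := lintegral_lintegral_swap hk.aemeasurable
  have e4 : ∀ ξ, (∫⁻ η, k ξ η) + (∫⁻ η, k η ξ) = g ξ * ∫⁻ η, g η := by
    intro ξ
    have hk1 : Measurable (k ξ) := hk.of_uncurry_left
    rw [← lintegral_add_left hk1,
      ← lintegral_const_mul _ hg]
    apply lintegral_congr_ae
    have : ∀ᵐ η : E4, η ∉ Metric.sphere (0 : E4) ‖ξ‖ := by
      rw [← measure_eq_zero_iff_ae_notMem]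
      exact Measure.addHaar_sphere _ _ _
    filter_upwards [this] with η hη
    simp only [mem_sphere_iff_norm, sub_zero] at hη
    rcases lt_or_gt_of_ne hη with h | h
    · simp [k, h.le, not_le.2 h]
    · simp [k, h.le, not_le.2 h, mul_comm]
  rw [e2]
  refine le_of_eq ?_
  have : 2 * ∫⁻ ξ, ∫⁻ η, k ξ η = (∫⁻ ξ, g ξ) ^ 2 := by
    rw [two_mul]
    nth_rewrite 2 [e3]
    rw [← lintegral_add_left hk.lintegral_prod_right]
    simp_rw [e4]
    rw [lintegral_mul_const _ hg, sq]
  rw [← this]; ring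

lemma layer (a : ℝ) (ha : 0 ≤ a) :
    ENNReal.ofReal (a ^ 4) ≤
      6 * ∫⁻ t in Set.Ioi (0 : ℝ), ENNReal.ofReal ((max (a - √t) 0) ^ 2) := by
  have hI : IntegrableOn (fun t : ℝ => (a - √t) ^ 2) (Set.Ioc 0 (a ^ 2)) :=
    ((by fun_prop : Continuous fun t : ℝ => (a - √t) ^ 2).integrableOn_Icc).mono_set
      Set.Ioc_subset_Icc_self
  have e : ∫ t in Set.Ioc 0 (a ^ 2), (a - √t) ^ 2 = a ^ 4 / 6 := by
    rw [← intervalIntegral.integral_of_le (by positivity)]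
    have := intervalIntegral.integral_eq_sub_of_hasDerivAt_of_le (a := 0) (b := a ^ 2)
      (f := fun t => a ^ 2 * t - (4 / 3) * a * (t * √t) + t ^ 2 / 2)
      (f' := fun t => (a - √t) ^ 2) (by positivity) (by fun_prop) ?_
      ((by fun_prop : Continuous fun t : ℝ => (a - √t) ^ 2).intervalIntegrable _ _)
    · rw [this, Real.sqrt_sq ha]; simp; ring
    · intro t ht
      have ht0 : 0 < t := ht.1
      have h1 := (Real.hasDerivAt_sqrt ht0.ne')
      have h2 := ((hasDerivAt_id t).mul h1).const_mul ((4 / 3) * a)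
      have h3 := (((hasDerivAt_id t).const_mul (a ^ 2)).sub h2).add
        (((hasDerivAt_id t).pow 2).div_const 2)
      convert! h3 using 1
      have hs : √t ^ 2 = t := Real.sq_sqrt ht0.le
      have hs0 : √t ≠ 0 := (Real.sqrt_pos.2 ht0).ne'
      simp only [id]
      have : t * (1 / (2 * √t)) = √t / 2 := by
        field_simp; rw [hs]
      rw [this]
      push_cast
      nlinarith [hs]
  calc ENNReal.ofReal (a ^ 4) = 6 * ENNReal.ofReal (a ^ 4 / 6) := by
        rw [show (6 : ℝ≥0∞) = ENNReal.ofReal 6 by simp, ← ENNReal.ofReal_mul (by norm_num)]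
        congr 1; ring
    _ = 6 * ∫⁻ t in Set.Ioc 0 (a ^ 2), ENNReal.ofReal ((a - √t) ^ 2) := by
        rw [← e, ofReal_integral_eq_lintegral_ofReal hI
          (Filter.Eventually.of_forall fun t => by positivity)]
    _ = 6 * ∫⁻ t in Set.Ioc 0 (a ^ 2), ENNReal.ofReal ((max (a - √t) 0) ^ 2) := by
        congr 1
        apply setLIntegral_congr_fun measurableSet_Ioc
        intro t ht
        have : √t ≤ a := by
          rw [Real.sqrt_le_left ha]; exact ht.2
        simp only
        rw [max_eq_left (by linarith)]
    _ ≤ _ := by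
        gcongr
        exact Set.Ioc_subset_Ioi_self

lemma sobolev_freq (v : E4 → ℝ) (hv : Continuous v) (h1 : Integrable (fun x => (v x : ℂ)))
    (h2 : MemLp (fun x => (v x : ℂ)) 2 volume) :
    ∫⁻ x, ENNReal.ofReal (v x ^ 4) ≤
      3 * (ENNReal.ofReal (π ^ 2) *
        (∫⁻ ξ, gdens (fun ξ => ‖𝓕 (fun x => (v x : ℂ)) ξ‖ₑ) ξ) ^ 2) := by
  set vc : E4 → ℂ := fun x => (v x : ℂ) with hvc
  have hc : Continuous (𝓕 vc) :=
    VectorFourier.fourierIntegral_continuous Real.continuous_fourierChar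
      (by exact continuous_inner) h1
  set q : E4 → ℝ≥0∞ := fun ξ => ‖𝓕 vc ξ‖ₑ with hqd
  have hq : Measurable q := hc.enorm.measurable
  -- measurability of Λ
  have hLam : Measurable (fun ξ : E4 => Lam q ‖ξ‖) := by
    have hm : Monotone (fun r : ℝ => Lam q (max r 0)) := fun a b hab =>
      Lam_mono q (le_max_right _ _) (max_le_max_right _ hab)
    have := hm.measurable.comp (measurable_norm (α := E4))
    have e : (fun ξ : E4 => Lam q ‖ξ‖) = (fun r : ℝ => Lam q (max r 0)) ∘ norm := by
      ext ξ; simp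
    rw [e]; exact this
  have step : ∀ t ∈ Set.Ioi (0 : ℝ),
      ∫⁻ x, ENNReal.ofReal ((max (|v x| - √t) 0) ^ 2) ≤
        ∫⁻ ξ, (if ENNReal.ofReal t ≤ Lam q ‖ξ‖ then q ξ ^ 2 else 0) := by
    intro t ht
    have ht0 : (0 : ℝ) < t := ht
    have hLm : MeasurableSet {ξ : E4 | Lam q ‖ξ‖ < ENNReal.ofReal t} :=
      measurableSet_lt hLam measurable_const
    obtain ⟨low, hl1, hl2⟩ := fourier_split vc h1 h2 {ξ : E4 | Lam q ‖ξ‖ < ENNReal.ofReal t}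
      hLm (ENNReal.ofReal √t) ENNReal.ofReal_ne_top
      (lowset_bound q hq _ _ (by
        rw [← ENNReal.ofReal_pow (Real.sqrt_nonneg _), Real.sq_sqrt ht0.le]))
    calc ∫⁻ x, ENNReal.ofReal ((max (|v x| - √t) 0) ^ 2)
        ≤ ∫⁻ x, ‖vc x - low x‖ₑ ^ 2 := by
          apply lintegral_mono
          intro x
          simp only
          rw [← ofReal_norm, ← ENNReal.ofReal_pow (norm_nonneg _)]
          apply ENNReal.ofReal_le_ofReal
          apply pow_le_pow_left₀ (le_max_right _ _)
          apply max_le _ (norm_nonneg _)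
          have a := hl1 x
          rw [← ofReal_norm, ENNReal.ofReal_le_ofReal_iff (Real.sqrt_nonneg _)] at a
          have b := norm_sub_norm_le (vc x) (low x)
          have c : ‖vc x‖ = |v x| := by simp [hvc]
          linarith
      _ ≤ _ := hl2
      _ = _ := by
          rw [← lintegral_indicator hLm.compl]
          congr 1; ext ξ
          by_cases h : ENNReal.ofReal t ≤ Lam q ‖ξ‖
          · rw [Set.indicator_of_mem (by simpa using h), if_pos h]
          · rw [Set.indicator_of_notMem (by simpa using h), if_neg h]
  have hm1 : Measurable (Function.uncurry fun (x : E4) (t : ℝ) =>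
      ENNReal.ofReal ((max (|v x| - √t) 0) ^ 2)) := by
    have := hv.measurable
    unfold Function.uncurry
    fun_prop
  have hm2 : Measurable (Function.uncurry fun (t : ℝ) (ξ : E4) =>
      (if ENNReal.ofReal t ≤ Lam q ‖ξ‖ then q ξ ^ 2 else 0)) := by
    refine Measurable.ite ?_ (by fun_prop) measurable_const
    exact measurableSet_le (by fun_prop) (hLam.comp measurable_snd)
  calc ∫⁻ x, ENNReal.ofReal (v x ^ 4)
      ≤ ∫⁻ x, 6 * ∫⁻ t in Set.Ioi (0 : ℝ), ENNReal.ofReal ((max (|v x| - √t) 0) ^ 2) := by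
        apply lintegral_mono
        intro x
        have := layer |v x| (abs_nonneg _)
        have e : |v x| ^ 4 = v x ^ 4 := by
          rw [show (4 : ℕ) = 2 * 2 from rfl, pow_mul, sq_abs, pow_mul]
        rwa [e] at this
    _ = 6 * ∫⁻ t in Set.Ioi (0 : ℝ), ∫⁻ x, ENNReal.ofReal ((max (|v x| - √t) 0) ^ 2) := by
        rw [lintegral_const_mul _ hm1.lintegral_prod_right, lintegral_lintegral_swap]
        exact hm1.aemeasurable
    _ ≤ 6 * ∫⁻ t in Set.Ioi (0 : ℝ), ∫⁻ ξ,
          (if ENNReal.ofReal t ≤ Lam q ‖ξ‖ then q ξ ^ 2 else 0) := by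
        gcongr 6 * ?_
        exact setLIntegral_mono' measurableSet_Ioi step
    _ = 6 * ∫⁻ ξ, ∫⁻ t in Set.Ioi (0 : ℝ),
          (if ENNReal.ofReal t ≤ Lam q ‖ξ‖ then q ξ ^ 2 else 0) := by
        rw [lintegral_lintegral_swap]
        exact hm2.aemeasurable
    _ ≤ 6 * ∫⁻ ξ, q ξ ^ 2 * Lam q ‖ξ‖ := by
        gcongr with ξ
        have hS : MeasurableSet {t : ℝ | ENNReal.ofReal t ≤ Lam q ‖ξ‖} :=
          measurableSet_le (by fun_prop) measurable_const
        have : ∀ t : ℝ, (if ENNReal.ofReal t ≤ Lam q ‖ξ‖ then q ξ ^ 2 else 0)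
            = {t : ℝ | ENNReal.ofReal t ≤ Lam q ‖ξ‖}.indicator (fun _ => q ξ ^ 2) t := by
          intro t; simp [Set.indicator]
        simp_rw [this]
        rw [lintegral_indicator hS, lintegral_const, Measure.restrict_apply_univ,
          Measure.restrict_apply hS]
        gcongr
        by_cases htop : Lam q ‖ξ‖ = ⊤
        · rw [htop]; exact le_top
        · calc volume ({t : ℝ | ENNReal.ofReal t ≤ Lam q ‖ξ‖} ∩ Set.Ioi 0)
              ≤ volume (Set.Ioc 0 (Lam q ‖ξ‖).toReal) := by
                apply measure_mono
                rintro t ⟨h, h0⟩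
                exact ⟨h0, (ENNReal.ofReal_le_iff_le_toReal htop).1 h⟩
            _ = Lam q ‖ξ‖ := by
                rw [Real.volume_Ioc, sub_zero, ENNReal.ofReal_toReal htop]
    _ = 3 * (2 * ∫⁻ ξ, q ξ ^ 2 * Lam q ‖ξ‖) := by
        rw [← mul_assoc]; norm_num
    _ ≤ _ := by
        gcongr 3 * ?_
        exact sym_bound q hq

lemma norm_sq_dual (l : E4 →L[ℝ] ℝ) :
    ‖l‖ ^ 2 = ∑ i, (l (EuclideanSpace.single i 1)) ^ 2 := by
  set y := (InnerProductSpace.toDual ℝ E4).symm l with hy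
  have h1 : ‖l‖ = ‖y‖ := by simp [hy]
  have h2 : ∀ x, l x = inner ℝ y x := fun x => by simp [hy]
  rw [h1, EuclideanSpace.norm_sq_eq]
  congr 1; ext i
  rw [h2]; simp [EuclideanSpace.inner_single_right]

lemma grad_freq (v : E4 → ℝ) (hd : Differentiable ℝ v) (h1 : Integrable v)
    (hg1 : Integrable (fderiv ℝ v)) (hg2 : MemLp (fderiv ℝ v) 2 volume) :
    ENNReal.ofReal (4 * π ^ 2) * ∫⁻ ξ, gdens (fun ξ => ‖𝓕 (fun x => (v x : ℂ)) ξ‖ₑ) ξ ≤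
      ∫⁻ x, ENNReal.ofReal (‖fderiv ℝ v x‖ ^ 2) := by
  set vc : E4 → ℂ := fun x => (v x : ℂ) with hvc
  have h1c : Integrable vc := h1.ofReal
  have hc : Continuous (𝓕 vc) :=
    VectorFourier.fourierIntegral_continuous Real.continuous_fourierChar
      (by exact continuous_inner) h1c
  have hfd : ∀ x, fderiv ℝ vc x = Complex.ofRealCLM.comp (fderiv ℝ v x) := fun x =>
    (Complex.ofRealCLM.hasFDerivAt.comp x (hd x).hasFDerivAt).fderiv
  have hdc : Differentiable ℝ vc := fun x =>
    (Complex.ofRealCLM.hasFDerivAt.comp x (hd x).hasFDerivAt).differentiableAt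
  have hfd' : fderiv ℝ vc = fun x =>
      (ContinuousLinearMap.compL ℝ E4 ℝ ℂ Complex.ofRealCLM) (fderiv ℝ v x) := by
    ext1 x; rw [hfd]; rfl
  have hg1c : Integrable (fderiv ℝ vc) := by
    rw [hfd']; exact ContinuousLinearMap.integrable_comp _ hg1
  have hF := Real.fourier_fderiv h1c hdc hg1c
  let p : Fin 4 → E4 → ℂ := fun i x => ((fderiv ℝ v x (EuclideanSpace.single i 1) : ℝ) : ℂ)
  have hp1 : ∀ i, Integrable (p i) := fun i => by
    have : Integrable (fun x => fderiv ℝ v x (EuclideanSpace.single i 1)) :=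
      ContinuousLinearMap.integrable_comp
        (ContinuousLinearMap.apply ℝ ℝ (EuclideanSpace.single i (1 : ℝ) : E4)) hg1
    exact this.ofReal
  have hp2 : ∀ i, MemLp (p i) 2 volume := fun i => by
    have : MemLp (fun x => fderiv ℝ v x (EuclideanSpace.single i 1)) 2 volume :=
      ContinuousLinearMap.comp_memLp'
        (ContinuousLinearMap.apply ℝ ℝ (EuclideanSpace.single i (1 : ℝ) : E4)) hg2
    exact this.ofReal
  have hpF : ∀ i ξ, 𝓕 (p i) ξ = 2 * π * Complex.I * (ξ i : ℂ) * 𝓕 vc ξ := by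
    intro i ξ
    have e1 : 𝓕 (p i) ξ = 𝓕 (fderiv ℝ vc) ξ (EuclideanSpace.single i 1) := by
      have hpe : p i = fun x => fderiv ℝ vc x (EuclideanSpace.single i 1) := by
        ext x; simp [p, hfd]
      rw [Real.fourier_continuousLinearMap_apply hg1c, hpe]
    rw [e1, hF]
    have e3 : (innerSL ℝ ξ) (EuclideanSpace.single i (1 : ℝ)) = ξ i := by
      rw [innerSL_apply_apply]; simp [EuclideanSpace.inner_single_right]
    simp [VectorFourier.fourierSMulRight_apply, e3]
    ring
  have e2 : ∀ ξ, ENNReal.ofReal (4 * π ^ 2) * gdens (fun ξ => ‖𝓕 vc ξ‖ₑ) ξ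
      = ∑ i, ‖𝓕 (p i) ξ‖ₑ ^ 2 := by
    intro ξ
    unfold gdens
    simp only [← ofReal_norm, hpF]
    simp only [← ENNReal.ofReal_pow (norm_nonneg _)]
    rw [← ENNReal.ofReal_mul (by positivity), ← ENNReal.ofReal_mul (by positivity),
      ← ENNReal.ofReal_sum_of_nonneg (fun i _ => by positivity)]
    congr 1
    simp only [norm_mul, mul_pow, EuclideanSpace.norm_sq_eq ξ, Complex.norm_real, Complex.norm_I]
    rw [← Finset.sum_mul, ← Finset.mul_sum]
    simp
    ring
  calc _ = ∫⁻ ξ, ∑ i, ‖𝓕 (p i) ξ‖ₑ ^ 2 := by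
        rw [← lintegral_const_mul _ (gdens_meas hc.enorm.measurable)]
        simp_rw [e2]
    _ = ∑ i, ∫⁻ ξ, ‖𝓕 (p i) ξ‖ₑ ^ 2 := by
        apply lintegral_finsetSum
        intro i _
        have : Continuous (𝓕 (p i)) :=
          VectorFourier.fourierIntegral_continuous Real.continuous_fourierChar
            (by exact continuous_inner) (hp1 i)
        exact this.enorm.measurable.pow_const 2
    _ = ∑ i, ∫⁻ x, ‖p i x‖ₑ ^ 2 := by
        congr 1; ext i; exact planch _ (hp1 i) (hp2 i)
    _ = ∫⁻ x, ∑ i, ‖p i x‖ₑ ^ 2 := by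
        symm
        apply lintegral_finsetSum'
        intro i _
        exact (hp1 i).1.enorm.pow_const 2
    _ ≤ _ := by
        apply lintegral_mono
        intro x
        simp only
        rw [norm_sq_dual, ENNReal.ofReal_sum_of_nonneg (fun i _ => by positivity)]
        apply le_of_eq
        congr 1; ext i
        rw [← ofReal_norm, ← ENNReal.ofReal_pow (norm_nonneg _)]
        congr 1
        simp [p]

/-- Sobolev inequality (within a factor `2` of sharp) for compactly supported-like functions. -/
lemma sobolev_v (v : E4 → ℝ) (hd : Differentiable ℝ v) (h1 : Integrable v)
    (h2 : MemLp v 2 volume)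
    (hg1 : Integrable (fderiv ℝ v)) (hg2 : MemLp (fderiv ℝ v) 2 volume) :
    ∫⁻ x, ENNReal.ofReal (v x ^ 4) ≤
      ENNReal.ofReal (3 / (16 * π ^ 2)) * (∫⁻ x, ENNReal.ofReal (‖fderiv ℝ v x‖ ^ 2)) ^ 2 := by
  have a := sobolev_freq v hd.continuous h1.ofReal h2.ofReal
  have b := grad_freq v hd h1 hg1 hg2
  refine a.trans ?_
  have b' := pow_le_pow_left₀ zero_le b 2
  refine le_trans (le_of_eq ?_) (mul_le_mul_right b' (ENNReal.ofReal (3 / (16 * π ^ 2))))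
  rw [mul_pow, ← mul_assoc, ← mul_assoc, ← ENNReal.ofReal_pow (by positivity),
    ← ENNReal.ofReal_mul (by positivity), show (3 : ℝ≥0∞) = ENNReal.ofReal 3 by simp,
    ← ENNReal.ofReal_mul (by positivity)]
  congr 2
  have := pi_pos
  field_simp
  ring

lemma normW (x : E4) : ‖fderiv ℝ W x‖ ^ 2 = (‖x‖ / 4 * ((1 + ‖x‖ ^ 2 / 8) ^ 2)⁻¹) ^ 2 := by
  have hpos : (1 + ‖x‖ ^ 2 / 8) ≠ 0 := by positivity
  have h1 : HasFDerivAt (fun x : E4 => 1 + ‖x‖ ^ 2 / 8) ((8 : ℝ)⁻¹ • (2 • innerSL ℝ x)) x := by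
    have h0 := ((hasStrictFDerivAt_norm_sq x).hasFDerivAt.const_mul ((8 : ℝ)⁻¹)).const_add 1
    convert! h0 using 1
    ext y; ring
  have h2 := (hasDerivAt_inv hpos).comp_hasFDerivAt x h1
  have h3 : fderiv ℝ W x = (-((1 + ‖x‖ ^ 2 / 8) ^ 2)⁻¹) • ((8 : ℝ)⁻¹ • (2 • innerSL ℝ x)) :=
    h2.fderiv
  have h2s : (2 • innerSL ℝ x : E4 →L[ℝ] ℝ) = (2 : ℝ) • innerSL ℝ x := by
    rw [two_nsmul, two_smul]
  rw [h3, h2s, norm_smul, norm_smul, norm_smul, innerSL_apply_norm]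
  rw [norm_neg, norm_inv, norm_inv, norm_pow]
  simp only [Real.norm_eq_abs]
  rw [abs_of_pos (by positivity : (0 : ℝ) < 1 + ‖x‖ ^ 2 / 8)]
  norm_num
  ring

lemma intW : ∫ x : E4, ‖fderiv ℝ W x‖ ^ 2 = 32 * π ^ 2 / 3 := by
  simp_rw [normW]
  rw [polar4 (fun r => (r / 4 * ((1 + r ^ 2 / 8) ^ 2)⁻¹) ^ 2)]
  have := integral_Ioi_of_hasDerivAt_of_nonneg' (a := 0)
    (g := fun y : ℝ => 16 / 3 * (1 - (1 + y ^ 2 / 8)⁻¹) ^ 3)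
    (g' := fun y => y ^ 3 * (y / 4 * ((1 + y ^ 2 / 8) ^ 2)⁻¹) ^ 2) (l := 16 / 3) ?_ ?_ ?_
  · rw [this]; norm_num; ring
  · intro y _
    have hpos : (1 + y ^ 2 / 8) ≠ 0 := by positivity
    have h1 : HasDerivAt (fun y : ℝ => 1 + y ^ 2 / 8) (2 * y / 8) y := by
      have := (((hasDerivAt_id y).pow 2).div_const 8).const_add 1
      convert! this using 1
      simp
    have h2 := (((h1.inv hpos).const_sub 1).pow 3).const_mul (16 / 3)
    convert! h2 using 1
    have e : 1 - (fun y : ℝ => 1 + y ^ 2 / 8)⁻¹ y = y ^ 2 / 8 * (1 + y ^ 2 / 8)⁻¹ := by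
      simp only [Pi.inv_apply]
      field_simp
      ring
    rw [e]
    push_cast
    field_simp
    ring
  · intro y hy
    have : (0 : ℝ) < y := hy
    positivity
  · have h1 : Filter.Tendsto (fun y : ℝ => 1 + y ^ 2 / 8) Filter.atTop Filter.atTop := by
      apply Filter.tendsto_atTop_add_const_left
      exact (Filter.tendsto_pow_atTop (by norm_num)).atTop_div_const (by norm_num)
    have h2 := (((tendsto_inv_atTop_zero.comp h1).const_sub 1).pow 3).const_mul (16 / 3)
    simpa using h2

lemma sr_memLp (v : E4 → ℝ) (hg : Integrable (fun x => ‖fderiv ℝ v x‖ ^ 2)) :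
    MemLp (fderiv ℝ v) 2 volume := by
  have hm : AEStronglyMeasurable (fderiv ℝ v) volume :=
    (measurable_fderiv ℝ v).aestronglyMeasurable
  exact (memLp_two_iff_integrable_sq_norm hm).2 hg

lemma sr_int (v : E4 → ℝ) (hs : HasCompactSupport v)
    (hg : Integrable (fun x => ‖fderiv ℝ v x‖ ^ 2)) : Integrable (fderiv ℝ v) := by
  have hm : AEStronglyMeasurable (fderiv ℝ v) volume :=
    (measurable_fderiv ℝ v).aestronglyMeasurable
  have hcs : HasCompactSupport (fderiv ℝ v) := hs.fderiv ℝ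
  have hK : IsCompact (tsupport (fderiv ℝ v)) := hcs
  have hKm : MeasurableSet (tsupport (fderiv ℝ v)) := hK.measurableSet
  have hKi : Integrable ((tsupport (fderiv ℝ v)).indicator (fun _ => (1 : ℝ))) volume :=
    (integrable_indicator_iff hKm).2 (integrableOn_const hK.measure_lt_top.ne)
  refine (hKi.add hg).mono' hm (Filter.Eventually.of_forall fun x => ?_)
  rw [Pi.add_apply]
  by_cases hx : x ∈ tsupport (fderiv ℝ v)
  · rw [Set.indicator_of_mem hx]
    nlinarith [sq_nonneg (‖fderiv ℝ v x‖ - 1), norm_nonneg (fderiv ℝ v x)]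
  · rw [Set.indicator_of_notMem hx, image_eq_zero_of_notMem_tsupport hx]
    simp

lemma sr_v1 (v : E4 → ℝ) (hd : Continuous v) (hs : HasCompactSupport v) : Integrable v :=
  hd.integrable_of_hasCompactSupport hs

lemma sr_v2 (v : E4 → ℝ) (hd : Continuous v) (hs : HasCompactSupport v) :
    MemLp v 2 volume :=
  hd.memLp_of_hasCompactSupport hs

lemma sr_v4 (v : E4 → ℝ) (hd : Continuous v) (hs : HasCompactSupport v) :
    Integrable (fun x => v x ^ 4) := by
  have h3 : HasCompactSupport (fun x => v x ^ 4) :=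
    hs.mono (fun x hx => by
      simp only [Function.mem_support] at hx ⊢
      intro h; apply hx; rw [h]; simp)
  exact Continuous.integrable_of_hasCompactSupport (hd.pow 4) h3

lemma sobolev_real (v : E4 → ℝ) (hd : Differentiable ℝ v) (hs : HasCompactSupport v)
    (hg : Integrable (fun x => ‖fderiv ℝ v x‖ ^ 2)) :
    ∫ x, v x ^ 4 ≤ 3 / (16 * π ^ 2) * (∫ x, ‖fderiv ℝ v x‖ ^ 2) ^ 2 := by
  have key := sobolev_v v hd (sr_v1 v hd.continuous hs)
    (sr_v2 v hd.continuous hs) (sr_int v hs hg) (sr_memLp v hg)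
  have h4 : Integrable (fun x => v x ^ 4) := sr_v4 v hd.continuous hs
  rw [← ofReal_integral_eq_lintegral_ofReal h4 (Filter.Eventually.of_forall fun x => by positivity),
    ← ofReal_integral_eq_lintegral_ofReal hg (Filter.Eventually.of_forall fun x => by positivity),
    ← ENNReal.ofReal_pow (integral_nonneg fun x => by positivity),
    ← ENNReal.ofReal_mul (by positivity)] at key
  exact (ENNReal.ofReal_le_ofReal_iff (by positivity)).1 key

lemma cutoffs : ∃ (χ : ℕ → E4 → ℝ) (K : ℝ), ∀ n : ℕ,
    ContDiff ℝ ∞ (χ n) ∧ HasCompactSupport (χ n) ∧ (∀ x, 0 ≤ χ n x ∧ χ n x ≤ 1) ∧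
    (∀ x, ‖x‖ < n + 1 → χ n x = 1) ∧ (∫ x, ‖fderiv ℝ (χ n) x‖ ^ 4 = K) := by
  let φ : ContDiffBump (0 : E4) := ⟨1, 2, by norm_num, by norm_num⟩
  refine ⟨fun n x => φ (((n : ℝ) + 1)⁻¹ • x), ∫ x, ‖fderiv ℝ φ x‖ ^ 4, fun n => ?_⟩
  have hn : (0 : ℝ) < (n : ℝ) + 1 := by positivity
  have hd : ∀ x, fderiv ℝ (fun x => φ (((n : ℝ) + 1)⁻¹ • x)) x
      = ((n : ℝ) + 1)⁻¹ • fderiv ℝ φ (((n : ℝ) + 1)⁻¹ • x) := by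
    intro x
    exact fderiv_comp_smul _
  refine ⟨?_, ?_, ?_, ?_, ?_⟩
  · exact φ.contDiff.comp (contDiff_const_smul _)
  · exact φ.hasCompactSupport.comp_smul (by positivity)
  · exact fun x => ⟨φ.nonneg, φ.le_one⟩
  · intro x hx
    apply φ.one_of_mem_closedBall
    simp only [mem_closedBall_zero_iff, norm_smul, norm_inv, Real.norm_eq_abs, abs_of_pos hn]
    rw [inv_mul_le_iff₀ hn]
    simp only [φ]; linarith
  · simp_rw [hd, norm_smul, mul_pow]
    rw [integral_const_mul,
      Measure.integral_comp_smul volume (fun x => ‖fderiv ℝ φ x‖ ^ 4) (((n : ℝ) + 1)⁻¹)]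
    simp only [finrank_euclideanSpace, Fintype.card_fin, smul_eq_mul, norm_inv, Real.norm_eq_abs,
      abs_of_pos hn, abs_inv, abs_pow]
    field_simp

lemma int_fderiv4 (f : E4 → ℝ) (c1 : ContDiff ℝ ∞ f) (c2 : HasCompactSupport f) :
    Integrable (fun x => ‖fderiv ℝ f x‖ ^ 4) := by
  have hc : Continuous (fderiv ℝ f) := c1.continuous_fderiv (by simp)
  have h2 : HasCompactSupport (fderiv ℝ f) := c2.fderiv ℝ
  have h3 : HasCompactSupport (fun x => ‖fderiv ℝ f x‖ ^ 4) :=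
    h2.mono (fun x hx => by
      simp only [Function.mem_support] at hx ⊢
      intro h; apply hx; rw [h]; simp)
  exact Continuous.integrable_of_hasCompactSupport (hc.norm.pow 4) h3

set_option maxHeartbeats 1000000 in
lemma sobolev_u (u : E4 → ℝ) (hu : Differentiable ℝ u)
    (hgrad : Integrable (fun x => ‖fderiv ℝ u x‖ ^ 2) volume)
    (hL4 : Integrable (fun x => (u x) ^ 4) volume) :
    ∫ x, u x ^ 4 ≤ 3 / (16 * π ^ 2) * (∫ x, ‖fderiv ℝ u x‖ ^ 2) ^ 2 := by
  obtain ⟨χ, K, hχ⟩ := cutoffs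
  set D := ∫ x, ‖fderiv ℝ u x‖ ^ 2 with hD
  set T : ℕ → ℝ := fun n => ∫ x, {x : E4 | (n : ℝ) + 1 ≤ ‖x‖}.indicator (fun x => u x ^ 4) x with hT
  have hSm : ∀ n : ℕ, MeasurableSet {x : E4 | (n : ℝ) + 1 ≤ ‖x‖} := fun n =>
    measurableSet_le measurable_const measurable_norm
  have hT0 : Filter.Tendsto T Filter.atTop (nhds 0) := by
    rw [show (0 : ℝ) = ∫ _ : E4, (0 : ℝ) by simp]
    refine tendsto_integral_of_dominated_convergence (fun x => u x ^ 4)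
      (fun n => (hL4.indicator (hSm n)).1) hL4 (fun n => Filter.Eventually.of_forall fun x => ?_)
      (Filter.Eventually.of_forall fun x => ?_)
    · have h0 : 0 ≤ u x ^ 4 := by positivity
      by_cases h : (n : ℝ) + 1 ≤ ‖x‖
      · rw [Set.indicator_of_mem (by exact h), Real.norm_eq_abs, abs_of_nonneg h0]
      · simp [Set.indicator, h, h0]
    · apply tendsto_const_nhds.congr'
      obtain ⟨N, hN⟩ := exists_nat_ge ‖x‖
      filter_upwards [Filter.eventually_ge_atTop N] with n hn
      have : ¬ ((n : ℝ) + 1 ≤ ‖x‖) := by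
        have : (N : ℝ) ≤ n := by exact_mod_cast hn
        linarith
      simp [Set.indicator, this]
  have hvlim : Filter.Tendsto (fun n => ∫ x, (χ n x * u x) ^ 4) Filter.atTop
      (nhds (∫ x, u x ^ 4)) := by
    refine tendsto_integral_of_dominated_convergence (fun x => u x ^ 4)
      (fun n => ?_) hL4 (fun n => Filter.Eventually.of_forall fun x => ?_)
      (Filter.Eventually.of_forall fun x => ?_)
    · exact (((hχ n).1.continuous.mul hu.continuous).pow 4).aestronglyMeasurable
    · obtain ⟨a, b⟩ := (hχ n).2.2.1 x
      rw [Real.norm_eq_abs, abs_of_nonneg (by positivity), mul_pow]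
      have h0 : 0 ≤ u x ^ 4 := by positivity
      have : χ n x ^ 4 ≤ 1 := pow_le_one₀ a b
      nlinarith
    · apply tendsto_const_nhds.congr'
      obtain ⟨N, hN⟩ := exists_nat_ge ‖x‖
      filter_upwards [Filter.eventually_ge_atTop N] with n hn
      have : ‖x‖ < (n : ℝ) + 1 := by
        have : (N : ℝ) ≤ n := by exact_mod_cast hn
        linarith
      rw [(hχ n).2.2.2.1 x this, one_mul]
  -- key bound
  have bound : ∀ s : ℝ, 0 < s → ∀ n, ∫ x, (χ n x * u x) ^ 4 ≤ 3 / (16 * π ^ 2) *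
      ((1 + s) * D + ((1 + s⁻¹) / 2) * ((s ^ 2)⁻¹ * T n + s ^ 2 * K)) ^ 2 := by
    intro s hs n
    obtain ⟨c1, c2, c3, c4, c5⟩ := hχ n
    have dχ : Differentiable ℝ (χ n) := c1.differentiable (by simp)
    have hdv : Differentiable ℝ (fun x => χ n x * u x) := dχ.mul hu
    have hfd : ∀ x, fderiv ℝ (fun x => χ n x * u x) x
        = χ n x • fderiv ℝ u x + u x • fderiv ℝ (χ n) x := fun x =>
      fderiv_fun_mul (dχ x) (hu x)
    have hI4 : Integrable (fun x => ‖fderiv ℝ (χ n) x‖ ^ 4) := by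
      exact int_fderiv4 _ c1 c2
    have hIT := hL4.indicator (hSm n)
    have hIB := (hgrad.const_mul (1 + s)).add
      (((hIT.const_mul ((s ^ 2)⁻¹)).add (hI4.const_mul (s ^ 2))).const_mul ((1 + s⁻¹) / 2))
    have hpt : ∀ x, ‖fderiv ℝ (fun x => χ n x * u x) x‖ ^ 2 ≤
        (1 + s) * ‖fderiv ℝ u x‖ ^ 2 + ((1 + s⁻¹) / 2) *
        ((s ^ 2)⁻¹ * {x : E4 | (n : ℝ) + 1 ≤ ‖x‖}.indicator (fun x => u x ^ 4) x +
          s ^ 2 * ‖fderiv ℝ (χ n) x‖ ^ 4) := by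
      intro x
      obtain ⟨a, b⟩ := c3 x
      have n1 : ‖fderiv ℝ (fun x => χ n x * u x) x‖ ≤
          ‖fderiv ℝ u x‖ + |u x| * ‖fderiv ℝ (χ n) x‖ := by
        rw [hfd]
        refine (norm_add_le _ _).trans ?_
        rw [norm_smul, norm_smul, Real.norm_eq_abs, Real.norm_eq_abs, abs_of_nonneg a]
        have := norm_nonneg (fderiv ℝ u x)
        nlinarith
      set A := ‖fderiv ℝ u x‖
      set G := ‖fderiv ℝ (χ n) x‖ with hG
      have n2 := pow_le_pow_left₀ (norm_nonneg _) n1 2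
      have n3 : (A + |u x| * G) ^ 2 ≤ (1 + s) * A ^ 2 + (1 + s⁻¹) * (u x ^ 2 * G ^ 2) := by
        have e : (1 + s) * A ^ 2 + (1 + s⁻¹) * (u x ^ 2 * G ^ 2) - (A + |u x| * G) ^ 2
            = s⁻¹ * (s * A - |u x| * G) ^ 2 := by
          rw [← sq_abs (u x)]
          field_simp
          ring
        have : 0 ≤ s⁻¹ * (s * A - |u x| * G) ^ 2 := by positivity
        linarith
      have n4 : u x ^ 2 * G ^ 2 ≤ (1 / 2) *
          ((s ^ 2)⁻¹ * {x : E4 | (n : ℝ) + 1 ≤ ‖x‖}.indicator (fun x => u x ^ 4) x +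
          s ^ 2 * G ^ 4) := by
        by_cases h : (n : ℝ) + 1 ≤ ‖x‖
        · rw [Set.indicator_of_mem (by exact h)]
          have e : (1 / 2) * ((s ^ 2)⁻¹ * u x ^ 4 + s ^ 2 * G ^ 4) - u x ^ 2 * G ^ 2
              = (1 / 2) * (s ^ 2)⁻¹ * (u x ^ 2 - s ^ 2 * G ^ 2) ^ 2 := by
            field_simp
            ring
          have : 0 ≤ (1 / 2) * (s ^ 2)⁻¹ * (u x ^ 2 - s ^ 2 * G ^ 2) ^ 2 := by positivity
          linarith
        · have hz : fderiv ℝ (χ n) x = 0 := by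
            have : χ n =ᶠ[nhds x] fun _ => (1 : ℝ) := by
              have ho : IsOpen {y : E4 | ‖y‖ < (n : ℝ) + 1} :=
                isOpen_lt continuous_norm continuous_const
              filter_upwards [ho.mem_nhds (not_le.1 h)] with y hy
              exact c4 y hy
            rw [this.fderiv_eq]; simp
          rw [Set.indicator_of_notMem (by exact h), hG, hz]
          simp
      have hs' : 0 < 1 + s⁻¹ := by positivity
      have n5 := mul_le_mul_of_nonneg_left n4 hs'.le
      linarith
    have hgI : Integrable (fun x => ‖fderiv ℝ (fun x => χ n x * u x) x‖ ^ 2) := by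
      refine hIB.mono' ?_ (Filter.Eventually.of_forall fun x => ?_)
      · exact ((measurable_fderiv ℝ _).norm.pow_const 2).aestronglyMeasurable
      · rw [Real.norm_eq_abs, abs_of_nonneg (by positivity)]
        exact hpt x
    refine (sobolev_real _ hdv c2.mul_right hgI).trans ?_
    have hi : ∫ x, ‖fderiv ℝ (fun x => χ n x * u x) x‖ ^ 2 ≤
        (1 + s) * D + ((1 + s⁻¹) / 2) * ((s ^ 2)⁻¹ * T n + s ^ 2 * K) := by
      refine (integral_mono hgI hIB hpt).trans (le_of_eq ?_)
      rw [integral_add' (hgrad.const_mul (1 + s))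
        (((hIT.const_mul ((s ^ 2)⁻¹)).add (hI4.const_mul (s ^ 2))).const_mul ((1 + s⁻¹) / 2)),
        integral_const_mul, integral_const_mul]
      simp only [Pi.add_apply]
      rw [integral_add (hIT.const_mul ((s ^ 2)⁻¹)) (hI4.const_mul (s ^ 2)),
        integral_const_mul, integral_const_mul, c5]
    have hi0 : 0 ≤ ∫ x, ‖fderiv ℝ (fun x => χ n x * u x) x‖ ^ 2 :=
      integral_nonneg fun x => by positivity
    gcongr
  have bound2 : ∀ s : ℝ, 0 < s → ∫ x, u x ^ 4 ≤ 3 / (16 * π ^ 2) *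
      ((1 + s) * D + (s ^ 2 + s) / 2 * K) ^ 2 := by
    intro s hs
    have hlim := (((((hT0.const_mul ((s ^ 2)⁻¹)).add_const (s ^ 2 * K)).const_mul
      ((1 + s⁻¹) / 2)).const_add ((1 + s) * D)).pow 2).const_mul (3 / (16 * π ^ 2))
    have := le_of_tendsto_of_tendsto' hvlim hlim (bound s hs)
    refine this.trans (le_of_eq ?_)
    congr 3
    field_simp
    ring
  have hc : Filter.Tendsto (fun s : ℝ => 3 / (16 * π ^ 2) *
      ((1 + s) * D + (s ^ 2 + s) / 2 * K) ^ 2) (nhdsWithin 0 (Set.Ioi 0))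
      (nhds (3 / (16 * π ^ 2) * D ^ 2)) := by
    have : Continuous (fun s : ℝ => 3 / (16 * π ^ 2) *
      ((1 + s) * D + (s ^ 2 + s) / 2 * K) ^ 2) := by fun_prop
    have h := this.tendsto 0
    simp only [add_zero, one_mul] at h
    norm_num at h
    refine Filter.Tendsto.mono_left ?_ nhdsWithin_le_nhds
    convert h using 2
  refine ge_of_tendsto hc ?_
  filter_upwards [self_mem_nhdsWithin] with s hs
  exact bound2 s hs

/-- If `‖∇u‖_{L²} ≤ ‖∇W‖_{L²}` then the energy `E(u) = ∫(½|∇u|² − ¼u⁴) ≥ 0`. -/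
theorem energy_nonneg_below_threshold (u : EuclideanSpace ℝ (Fin 4) → ℝ)
    (hu : Differentiable ℝ u)
    (hgrad : Integrable (fun x => ‖fderiv ℝ u x‖ ^ 2) volume)
    (hL4 : Integrable (fun x => (u x) ^ 4) volume)
    (hsmall : (∫ x, ‖fderiv ℝ u x‖ ^ 2) ≤
      ∫ x : EuclideanSpace ℝ (Fin 4), ‖fderiv ℝ W x‖ ^ 2) :
    (0 : ℝ) ≤ ∫ x, ((1 / 2) * ‖fderiv ℝ u x‖ ^ 2 - (1 / 4) * (u x) ^ 4) := by
  rw [integral_sub (hgrad.const_mul _) (hL4.const_mul _), integral_const_mul, integral_const_mul]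
  have hS := sobolev_u u hu hgrad hL4
  rw [intW] at hsmall
  have hD : 0 ≤ ∫ x, ‖fderiv ℝ u x‖ ^ 2 := integral_nonneg fun x => by positivity
  set D := ∫ x, ‖fderiv ℝ u x‖ ^ 2
  have hpi := pi_pos
  have h2 : 3 / (16 * π ^ 2) * D ^ 2 ≤ 2 * D := by
    have h3 := mul_le_mul_of_nonneg_left hsmall
      (by positivity : 0 ≤ 3 / (16 * π ^ 2) * D)
    calc _ = 3 / (16 * π ^ 2) * D * D := by ring
      _ ≤ _ := h3
      _ = 2 * D := by field_simp; ring
  linarith
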